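/- Let (V, Ω) be a 6-dimensional symplectic vector space and ω an effective 3-form with Lychagin–Roubtsov quadratic form q_ω. For each X ∈ V, the characteristic identity (i_X ω − ξΩ)³ = −ξ(ξ² − q_ω(X)) Ω³ holds as an equation of 6-forms for every scalar ξ. -/

import Mathlib

/- Framework: exterior forms on a real vector space `V` are modelled as elements of the
exterior algebra of the dual space; a `k`-form is an element of the submodule
`⋀[ℝ]^k (Module.Dual ℝ V)`, and the wedge product is the algebra multiplication. -/

noncomputable section
open ExteriorAlgebra
set_option synthInstance.maxHeartbeats 1000000
set_option maxHeartbeats 1000000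

variable (V : Type) [AddCommGroup V] [Module ℝ V]

/-- The algebra of exterior forms on `V`. -/
abbrev EForm := ExteriorAlgebra ℝ (Module.Dual ℝ V)

variable {V}

/-- Interior product (contraction) of forms by a vector, linear in the vector. -/
def iContrL : V →ₗ[ℝ] Module.End ℝ (EForm V) :=
  (CliffordAlgebra.contractLeft (Q := (0 : QuadraticForm ℝ (Module.Dual ℝ V)))).comp
    (Module.Dual.eval ℝ V)

/-- Contraction of forms by an arbitrary element of the exterior algebra of `V`
(e.g. by a bivector), extending `iContrL` as an algebra morphism. -/
def aContr : ExteriorAlgebra ℝ V →ₐ[ℝ] Module.End ℝ (EForm V) :=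
  ExteriorAlgebra.lift ℝ ⟨iContrL, fun _ =>
    LinearMap.ext fun _ => CliffordAlgebra.contractLeft_contractLeft _ _⟩

/-- The bilinear form on `V` associated with an exterior 2-form, via double contraction
(the scalar part is extracted by `ExteriorAlgebra.algebraMapInv`). -/
def formToBilin (Om : EForm V) : V →ₗ[ℝ] V →ₗ[ℝ] ℝ :=
  LinearMap.mk₂ ℝ (fun x y => algebraMapInv (iContrL y (iContrL x Om)))
    (fun x x' y => by simp [map_add, LinearMap.add_apply])
    (fun c x y => by simp [map_smul, LinearMap.smul_apply])
    (fun x y y' => by simp [map_add, LinearMap.add_apply])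
    (fun c x y => by simp [map_smul, LinearMap.smul_apply])

/-- A 2-form is nondegenerate (symplectic) if its associated bilinear form is. -/
def IsSymplecticForm (Om : EForm V) : Prop :=
  Om ∈ ⋀[ℝ]^2 (Module.Dual ℝ V) ∧ ∀ x : V, (∀ y : V, formToBilin Om x y = 0) → x = 0

/-- The algebra morphism `⋀ V → ⋀ V*` induced by a linear map `Γ : V → V*`. -/
def extAlgMap (f : V →ₗ[ℝ] Module.Dual ℝ V) : ExteriorAlgebra ℝ V →ₐ[ℝ] EForm V :=
  ExteriorAlgebra.lift ℝ ⟨(ExteriorAlgebra.ι ℝ).comp f, fun _ => ι_sq_zero _⟩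

/-- `XOm` is the bivector dual to the symplectic form `Om`, i.e. the unique bivector with
`Γ^*(X_Ω) = Ω` where `Γ : V → V*` is the isomorphism induced by `Om`. -/
def IsDualBivector (Om : EForm V) (XOm : ExteriorAlgebra ℝ V) : Prop :=
  XOm ∈ ⋀[ℝ]^2 V ∧ extAlgMap (formToBilin Om) XOm = Om

/-- The pullback action on forms induced by an endomorphism `K : V → V`. -/
def formPullback (K : V →ₗ[ℝ] V) : EForm V →ₐ[ℝ] EForm V :=
  ExteriorAlgebra.lift ℝ ⟨(ExteriorAlgebra.ι ℝ).comp K.dualMap, fun _ => ι_sq_zero _⟩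


section Contraction

theorem iContrL_ι_mul (x : V) (a : Module.Dual ℝ V) (b : EForm V) :
    iContrL x (ι ℝ a * b) = a x • b - ι ℝ a * iContrL x b :=
  CliffordAlgebra.contractLeft_ι_mul _ _ _

theorem iContrL_ι (x : V) (a : Module.Dual ℝ V) :
    iContrL x (ι ℝ a) = algebraMap ℝ (EForm V) (a x) :=
  CliffordAlgebra.contractLeft_ι _ _ _

theorem iContrL_algebraMap (x : V) (r : ℝ) : iContrL x (algebraMap ℝ (EForm V) r) = 0 :=
  CliffordAlgebra.contractLeft_algebraMap _ _ _

theorem iContrL_iContrL_self (x : V) (b : EForm V) : iContrL x (iContrL x b) = 0 :=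
  CliffordAlgebra.contractLeft_contractLeft _ _

theorem iContrL_comm (x y : V) (b : EForm V) :
    iContrL x (iContrL y b) = -iContrL y (iContrL x b) :=
  CliffordAlgebra.contractLeft_comm _ _ _

theorem ι_mul_mem_exteriorPower {M : Type} [AddCommGroup M] [Module ℝ M] (a : M) {k : ℕ}
    {b : ExteriorAlgebra ℝ M} (hb : b ∈ ⋀[ℝ]^k M) : ι ℝ a * b ∈ ⋀[ℝ]^(k + 1) M := by
  rw [exteriorPower, pow_succ']
  exact Submodule.mul_mem_mul ⟨a, rfl⟩ hb

/-- Induction on the degree of homogeneous elements of an exterior algebra. -/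
theorem exteriorPower_induction {M : Type} [AddCommGroup M] [Module ℝ M]
    {C : ∀ (k : ℕ) (b : ExteriorAlgebra ℝ M), b ∈ ⋀[ℝ]^k M → Prop}
    (algebraMap : ∀ r : ℝ, C 0 (algebraMap ℝ _ r) (Submodule.algebraMap_mem r))
    (add : ∀ k b c hb hc, C k b hb → C k c hc → C k (b + c) (add_mem hb hc))
    (ι_mul : ∀ k a b hb, C k b hb → C (k + 1) (ι ℝ a * b) (ι_mul_mem_exteriorPower a hb))
    {k : ℕ} {b : ExteriorAlgebra ℝ M} (hb : b ∈ ⋀[ℝ]^k M) : C k b hb := by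
  induction hb using Submodule.pow_induction_on_left' with
  | algebraMap r => exact algebraMap r
  | add x y i hx hy hCx hCy => exact add _ _ _ _ _ hCx hCy
  | mem_mul m hm i x hx hCx =>
    obtain ⟨a, rfl⟩ := hm
    exact ι_mul _ _ _ _ hCx

theorem mul_mem_exteriorPower {M : Type} [AddCommGroup M] [Module ℝ M] {k l : ℕ}
    {b c : ExteriorAlgebra ℝ M} (hb : b ∈ ⋀[ℝ]^k M) (hc : c ∈ ⋀[ℝ]^l M) :
    b * c ∈ ⋀[ℝ]^(k + l) M := by
  rw [exteriorPower, pow_add]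
  exact Submodule.mul_mem_mul hb hc

theorem exists_eq_sum_of_mem_exteriorPower_two {M : Type} [AddCommGroup M] [Module ℝ M]
    {B : ExteriorAlgebra ℝ M} (hB : B ∈ ⋀[ℝ]^2 M) :
    ∃ (J : Type) (_ : Fintype J) (u v : J → M), B = ∑ j, ι ℝ (u j) * ι ℝ (v j) := by
  rw [exteriorPower, pow_two] at hB
  induction hB using Submodule.mul_induction_on' with
  | mem_mul_mem a ha b hb =>
    obtain ⟨a, rfl⟩ := ha
    obtain ⟨b, rfl⟩ := hb
    exact ⟨Unit, inferInstance, fun _ => a, fun _ => b, by simp⟩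
  | add b _ c _ hb hc =>
    obtain ⟨J, _, u, v, rfl⟩ := hb
    obtain ⟨K, _, u', v', rfl⟩ := hc
    exact ⟨J ⊕ K, inferInstance, Sum.elim u u', Sum.elim v v', by simp⟩

/-- Forms of degree two are central. -/
theorem two_form_commute {Om : EForm V} (hOm : Om ∈ ⋀[ℝ]^2 (Module.Dual ℝ V)) (b : EForm V) :
    Commute Om b := by
  obtain ⟨J, _, u, v, rfl⟩ := exists_eq_sum_of_mem_exteriorPower_two hOm
  refine Commute.sum_left _ _ _ fun j _ => ?_
  induction b using ExteriorAlgebra.induction with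
  | algebraMap r => exact (Algebra.commutes r _).symm
  | ι a =>
    have h1 := eq_neg_of_add_eq_zero_left (ι_add_mul_swap (R := ℝ) (v j) a)
    have h2 := eq_neg_of_add_eq_zero_left (ι_add_mul_swap (R := ℝ) (u j) a)
    rw [Commute, SemiconjBy, mul_assoc, h1, mul_neg, ← mul_assoc, h2, neg_mul, neg_neg, mul_assoc]
  | mul a b ha hb => exact ha.mul_right hb
  | add a b ha hb => exact ha.add_right hb

/-- Contraction with a vector is an antiderivation. -/
theorem iContrL_mul (x : V) {k : ℕ} {a : EForm V} (ha : a ∈ ⋀[ℝ]^k (Module.Dual ℝ V))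
    (b : EForm V) :
    iContrL x (a * b) = iContrL x a * b + (-1 : ℝ) ^ k • (a * iContrL x b) := by
  induction ha using exteriorPower_induction with
  | algebraMap r => simp [← Algebra.smul_def, iContrL_algebraMap]
  | add k c d _ _ hc hd => rw [add_mul, map_add, hc, hd, map_add, add_mul, add_mul]; module
  | ι_mul k c d hd h =>
    rw [mul_assoc, iContrL_ι_mul, h, iContrL_ι_mul, sub_mul, mul_add, mul_smul_comm, smul_mul_assoc,
      pow_succ]
    simp only [mul_assoc]
    module

theorem iContrL_mem (x : V) {k : ℕ} {b : EForm V} (hb : b ∈ ⋀[ℝ]^k (Module.Dual ℝ V)) :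
    iContrL x b ∈ ⋀[ℝ]^(k - 1) (Module.Dual ℝ V) := by
  induction hb using exteriorPower_induction with
  | algebraMap r => rw [iContrL_algebraMap]; exact zero_mem _
  | add k c d _ _ hc hd => rw [map_add]; exact add_mem hc hd
  | ι_mul k a b hb h =>
    rw [iContrL_ι_mul]
    refine sub_mem (Submodule.smul_mem _ _ hb) ?_
    cases k with
    | zero =>
      rw [exteriorPower, pow_zero, Submodule.mem_one] at hb
      obtain ⟨r, rfl⟩ := hb
      rw [iContrL_algebraMap, mul_zero]
      exact zero_mem _
    | succ k => exact ι_mul_mem_exteriorPower a h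

theorem iContrL_eq_zero (x : V) {b : EForm V} (hb : b ∈ ⋀[ℝ]^0 (Module.Dual ℝ V)) :
    iContrL x b = 0 := by
  rw [exteriorPower, pow_zero, Submodule.mem_one] at hb
  obtain ⟨r, rfl⟩ := hb
  exact iContrL_algebraMap x r

theorem iContrL_eq_ι_formToBilin {Om : EForm V} (hOm : Om ∈ ⋀[ℝ]^2 (Module.Dual ℝ V)) (x : V) :
    iContrL x Om = ι ℝ (formToBilin Om x) := by
  obtain ⟨J, _, u, v, rfl⟩ := exists_eq_sum_of_mem_exteriorPower_two hOm
  have key : iContrL x (∑ j, ι ℝ (u j) * ι ℝ (v j)) = ι ℝ (∑ j, (u j x • v j - v j x • u j)) := by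
    simp only [map_sum, iContrL_ι_mul, iContrL_ι, map_sub, map_smul]
    refine Finset.sum_congr rfl fun j _ => ?_
    rw [← Algebra.commutes, ← Algebra.smul_def]
  rw [key]
  congr 1
  ext y
  change _ = algebraMapInv (iContrL y (iContrL x _))
  rw [key, iContrL_ι, algebraMap_leftInverse]

theorem formToBilin_swap (Om : EForm V) (x y : V) :
    formToBilin Om x y = -formToBilin Om y x := by
  change algebraMapInv (iContrL y (iContrL x _)) = -algebraMapInv (iContrL x (iContrL y _))
  rw [iContrL_comm, map_neg]

theorem aContr_ι_mul_ι (u v : V) (b : EForm V) :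
    aContr (ι ℝ u * ι ℝ v) b = iContrL u (iContrL v b) := by
  rw [map_mul, Module.End.mul_apply]
  simp [aContr]

theorem aContr_mem {B : ExteriorAlgebra ℝ V} (hB : B ∈ ⋀[ℝ]^2 V) {k : ℕ} {b : EForm V}
    (hb : b ∈ ⋀[ℝ]^k (Module.Dual ℝ V)) : aContr B b ∈ ⋀[ℝ]^(k - 2) (Module.Dual ℝ V) := by
  obtain ⟨J, _, u, v, rfl⟩ := exists_eq_sum_of_mem_exteriorPower_two hB
  rw [map_sum, LinearMap.sum_apply]
  refine sum_mem fun j _ => ?_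
  rw [aContr_ι_mul_ι]
  exact iContrL_mem _ (iContrL_mem _ hb)

theorem aContr_eq_zero {B : ExteriorAlgebra ℝ V} (hB : B ∈ ⋀[ℝ]^2 V) {b : EForm V}
    (hb : b ∈ ⋀[ℝ]^0 (Module.Dual ℝ V)) : aContr B b = 0 := by
  obtain ⟨J, _, u, v, rfl⟩ := exists_eq_sum_of_mem_exteriorPower_two hB
  rw [map_sum, LinearMap.sum_apply]
  refine Finset.sum_eq_zero fun j _ => ?_
  rw [aContr_ι_mul_ι, iContrL_eq_zero _ hb, map_zero]

end Contraction

section Lefschetz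

/-- The Euler identity for exterior forms, for a resolution `∑ φ j ⊗ w j` of the identity. -/
theorem sum_ι_mul_iContrL {J : Type} [Fintype J] {φ : J → Module.Dual ℝ V} {w : J → V}
    (hφ : ∀ x, ∑ j, φ j x • w j = x) {k : ℕ} {b : EForm V}
    (hb : b ∈ ⋀[ℝ]^k (Module.Dual ℝ V)) :
    ∑ j, ι ℝ (φ j) * iContrL (w j) b = (k : ℝ) • b := by
  induction hb using exteriorPower_induction with
  | algebraMap r => simp [iContrL_algebraMap]
  | add k c d _ _ hc hd => simp only [map_add, mul_add, Finset.sum_add_distrib, hc, hd, smul_add]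
  | ι_mul k a b hb h =>
    have ha : ∑ j, a (w j) • φ j = a := by
      ext x
      conv_rhs => rw [← hφ x]
      simp [mul_comm]
    have h1 : ∀ j, ι ℝ (φ j) * iContrL (w j) (ι ℝ a * b) =
        ι ℝ (a (w j) • φ j) * b + ι ℝ a * (ι ℝ (φ j) * iContrL (w j) b) := by
      intro j
      rw [iContrL_ι_mul, mul_sub, ← mul_assoc, ← mul_assoc,
        eq_neg_of_add_eq_zero_left (ι_add_mul_swap (R := ℝ) (φ j) a)]
      simp
    rw [Finset.sum_congr rfl fun j _ => h1 j, Finset.sum_add_distrib, ← Finset.sum_mul,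
      ← Finset.mul_sum, h, ← map_sum, ha, mul_smul_comm]
    push_cast
    module

theorem sum_apply_eq_finrank [FiniteDimensional ℝ V] {J : Type} [Fintype J]
    {φ : J → Module.Dual ℝ V} {w : J → V} (hφ : ∀ x, ∑ j, φ j x • w j = x) :
    ∑ j, φ j (w j) = Module.finrank ℝ V := by
  have h : dualTensorHom ℝ V V (∑ j, φ j ⊗ₜ[ℝ] w j) = LinearMap.id := by
    ext x
    simp [dualTensorHom_apply, hφ]
  rw [← LinearMap.trace_id (R := ℝ) (M := V), ← h, LinearMap.trace_eq_contract_apply]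
  simp

/-- The Lefschetz commutation relation; with the present sign convention, contraction with the
dual bivector is the opposite of the usual dual Lefschetz operator. -/
theorem aContr_mul [FiniteDimensional ℝ V] {Om : EForm V} (hOm : IsSymplecticForm Om)
    {B : ExteriorAlgebra ℝ V} (hB : IsDualBivector Om B) {k : ℕ} {b : EForm V}
    (hb : b ∈ ⋀[ℝ]^k (Module.Dual ℝ V)) :
    aContr B (Om * b) = Om * aContr B b + ((k : ℝ) - Module.finrank ℝ V / 2) • b := by
  obtain ⟨hB2, hBO⟩ := hB
  obtain ⟨J, _, u, v, rfl⟩ := exists_eq_sum_of_mem_exteriorPower_two hB2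
  set Γ := formToBilin Om with hΓ
  have hΓι : ∀ x, iContrL x Om = ι ℝ (Γ x) := iContrL_eq_ι_formToBilin hOm.1
  have hOmsum : Om = ∑ j, ι ℝ (Γ (u j)) * ι ℝ (Γ (v j)) := by
    conv_lhs => rw [← hBO]
    simp [extAlgMap]
  have hinj : Function.Injective Γ := by
    refine (injective_iff_map_eq_zero Γ).2 fun x hx => hOm.2 x fun y => ?_
    rw [← hΓ, hx, LinearMap.zero_apply]
  let φ : J ⊕ J → Module.Dual ℝ V := Sum.elim (fun j => Γ (u j)) (fun j => -Γ (v j))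
  let w : J ⊕ J → V := Sum.elim v u
  have hφ : ∀ x, ∑ j, φ j x • w j = x := by
    intro x
    apply hinj
    apply (ι_leftInverse (R := ℝ)).injective
    rw [← hΓι x, hOmsum]
    simp only [φ, w, Fintype.sum_sum_type, Sum.elim_inl, Sum.elim_inr, map_add, map_sum,
      map_smul, iContrL_ι_mul, iContrL_ι, ← Finset.sum_add_distrib]
    refine Finset.sum_congr rfl fun j _ => ?_
    rw [← Algebra.commutes, ← Algebra.smul_def, LinearMap.neg_apply]
    module
  have htrace := sum_apply_eq_finrank hφ
  have heuler := sum_ι_mul_iContrL hφ hb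
  simp only [φ, w, Fintype.sum_sum_type, Sum.elim_inl, Sum.elim_inr, LinearMap.neg_apply,
    ← Finset.sum_add_distrib, map_neg, neg_mul] at htrace heuler
  have hterm : ∀ j, iContrL (u j) (iContrL (v j) (Om * b)) =
      Om * iContrL (u j) (iContrL (v j) b) +
      (ι ℝ (Γ (u j)) * iContrL (v j) b + -(ι ℝ (Γ (v j)) * iContrL (u j) b)) +
      (-(1 / 2 : ℝ) * (Γ (u j) (v j) + -Γ (v j) (u j))) • b := by
    intro j
    rw [iContrL_mul _ hOm.1, hΓι, map_add, map_smul, iContrL_ι_mul, iContrL_mul _ hOm.1, hΓι,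
      formToBilin_swap Om (u j) (v j)]
    module
  rw [map_sum, LinearMap.sum_apply, LinearMap.sum_apply]
  simp only [aContr_ι_mul_ι]
  rw [Finset.sum_congr rfl fun j _ => hterm j, Finset.sum_add_distrib, Finset.sum_add_distrib,
    heuler, ← Finset.sum_smul, ← Finset.mul_sum, ← Finset.mul_sum, htrace]
  module

end Lefschetz

section TopForms

theorem eq_zero_of_finrank_lt [FiniteDimensional ℝ V] {k : ℕ} (hk : Module.finrank ℝ V < k)
    {b : EForm V} (hb : b ∈ ⋀[ℝ]^k (Module.Dual ℝ V)) : b = 0 := by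
  have h : Module.finrank ℝ (⋀[ℝ]^k (Module.Dual ℝ V)) = 0 := by
    rw [exteriorPower.finrank_eq, Subspace.dual_finrank_eq, Nat.choose_eq_zero_of_lt hk]
  rw [Submodule.finrank_eq_zero.1 h] at hb
  exact (Submodule.mem_bot ℝ).1 hb

theorem exists_smul_eq_top_form [FiniteDimensional ℝ V] {t : EForm V}
    (ht : t ∈ ⋀[ℝ]^(Module.finrank ℝ V) (Module.Dual ℝ V)) (ht0 : t ≠ 0) {b : EForm V}
    (hb : b ∈ ⋀[ℝ]^(Module.finrank ℝ V) (Module.Dual ℝ V)) : ∃ c : ℝ, b = c • t := by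
  have h : Module.finrank ℝ (⋀[ℝ]^(Module.finrank ℝ V) (Module.Dual ℝ V)) = 1 := by
    rw [exteriorPower.finrank_eq, Subspace.dual_finrank_eq, Nat.choose_self]
  obtain ⟨c, hc⟩ := exists_smul_eq_of_finrank_eq_one h (x := ⟨t, ht⟩)
    (fun h => ht0 (congrArg Subtype.val h)) ⟨b, hb⟩
  exact ⟨c, (congrArg Subtype.val hc).symm⟩

theorem top_form_eq_zero_of_iContrL_eq_zero [FiniteDimensional ℝ V] {b : EForm V}
    (hb : b ∈ ⋀[ℝ]^(Module.finrank ℝ V) (Module.Dual ℝ V)) {x : V} (hx : x ≠ 0)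
    (h : iContrL x b = 0) : b = 0 := by
  obtain ⟨f, hf⟩ : ∃ f : Module.Dual ℝ V, f x ≠ 0 := by
    by_contra! hf
    exact hx ((Module.forall_dual_apply_eq_zero_iff ℝ x).1 hf)
  have h0 : ι ℝ f * b = 0 :=
    eq_zero_of_finrank_lt (Nat.lt_succ_self _) (ι_mul_mem_exteriorPower f hb)
  have h1 := iContrL_ι_mul x f b
  rw [h0, h, map_zero, mul_zero, sub_zero] at h1
  exact (smul_eq_zero.1 h1.symm).resolve_left hf

end TopForms

/-- On a symplectic space of dimension six, wedging a 4-form with the symplectic form amounts to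
contracting it twice with the dual bivector. -/
theorem mul_four_form [FiniteDimensional ℝ V] (hdim : Module.finrank ℝ V = 6)
    {Om : EForm V} (hOm : IsSymplecticForm Om) {B : ExteriorAlgebra ℝ V}
    (hB : IsDualBivector Om B) {σ : EForm V} (hσ : σ ∈ ⋀[ℝ]^4 (Module.Dual ℝ V)) :
    Om * σ = ((1 / 12 : ℝ) * algebraMapInv (aContr B (aContr B σ))) • (Om * Om * Om) := by
  have L : ∀ {k : ℕ} {b : EForm V}, b ∈ ⋀[ℝ]^k (Module.Dual ℝ V) →
      aContr B (Om * b) = Om * aContr B b + ((k : ℝ) - 3) • b := by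
    intro k b hb
    rw [aContr_mul hOm hB hb, hdim]
    norm_num
  have one_mem : (1 : EForm V) ∈ ⋀[ℝ]^0 (Module.Dual ℝ V) := by
    rw [exteriorPower, pow_zero]
    exact Submodule.one_le.1 le_rfl
  have h3 : ∀ {τ : EForm V}, τ ∈ ⋀[ℝ]^4 (Module.Dual ℝ V) →
      aContr B (aContr B (aContr B (Om * τ))) = (-3 : ℝ) • aContr B (aContr B τ) := by
    intro τ hτ
    have h1 := aContr_mem hB.1 hτ
    have h2 := aContr_mem hB.1 h1
    rw [L hτ, map_add, L h1, map_smul, map_add, map_add, L h2, aContr_eq_zero hB.1 h2, map_smul,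
      map_smul, mul_zero]
    norm_num
  have hOO : Om * Om ∈ ⋀[ℝ]^4 (Module.Dual ℝ V) := mul_mem_exteriorPower hOm.1 hOm.1
  have hO : aContr B Om = (-3 : ℝ) • (1 : EForm V) := by
    have := L one_mem
    rw [mul_one, aContr_eq_zero hB.1 one_mem, mul_zero] at this
    rw [this]
    norm_num
  have h12 : aContr B (aContr B (Om * Om)) = (12 : ℝ) • (1 : EForm V) := by
    rw [L hOm.1, hO, map_add, map_smul, mul_smul_comm, mul_one, map_smul, hO]
    module
  have hO3 : aContr B (aContr B (aContr B (Om * Om * Om))) = (-36 : ℝ) • (1 : EForm V) := by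
    rw [mul_assoc, h3 hOO, h12]
    module
  have hne : Om * Om * Om ≠ 0 := by
    intro h
    rw [h, map_zero, map_zero, map_zero] at hO3
    exact smul_ne_zero (by norm_num) one_ne_zero hO3.symm
  obtain ⟨c, hc⟩ := exists_smul_eq_top_form (b := Om * σ)
    (by rw [hdim]; exact mul_mem_exteriorPower hOO hOm.1) hne
    (by rw [hdim]; exact mul_mem_exteriorPower hOm.1 hσ)
  have h := h3 hσ
  rw [hc, map_smul, map_smul, map_smul, hO3] at h
  have h' := congrArg algebraMapInv h
  simp only [map_smul, map_one, smul_eq_mul] at h'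
  rw [hc]
  congr 1
  linarith

/-- Characteristic identity: on a 6-dimensional symplectic vector space, for an effective
3-form `ω` with Lychagin–Roubtsov quadratic form `q_ω`, one has for every `X` and scalar
`ξ` the identity of 6-forms `(i_X ω - ξ Ω)³ = -ξ (ξ² - q_ω(X)) Ω³`. -/
theorem characteristic_identity [FiniteDimensional ℝ V]
    (hdim : Module.finrank ℝ V = 6)
    (Om : EForm V) (hOm : IsSymplecticForm Om)
    (XOm : ExteriorAlgebra ℝ V) (hX : IsDualBivector Om XOm)
    (ω : EForm V) (hω : ω ∈ ⋀[ℝ]^3 (Module.Dual ℝ V)) (heff : ω * Om = 0) :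
    ∀ (X : V) (ξ : ℝ),
      (iContrL X ω - ξ • Om) ^ 3 =
        (-ξ * (ξ ^ 2 -
          (-(1/4 : ℝ)) * algebraMapInv
            (aContr XOm (aContr XOm ((iContrL X ω) * (iContrL X ω)))))) • (Om * Om * Om) := by
  intro X ξ
  set α := iContrL X ω with hα
  have hO := hOm.1
  have hα2 : α ∈ ⋀[ℝ]^2 (Module.Dual ℝ V) := iContrL_mem X hω
  have hcomm : α * Om = Om * α := (two_form_commute hO α).eq.symm
  have hαα : iContrL X α = 0 := iContrL_iContrL_self X ω
  have hcube : α * (α * α) = 0 := by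
    by_cases hX0 : X = 0
    · simp [hα, hX0]
    · refine top_form_eq_zero_of_iContrL_eq_zero ?_ hX0 ?_
      · rw [hdim]
        exact mul_mem_exteriorPower hα2 (mul_mem_exteriorPower hα2 hα2)
      · rw [iContrL_mul X hα2, iContrL_mul X hα2, hαα]
        simp
  have hprim : α * (Om * Om) = 0 := by
    have h := iContrL_mul X hω (Om * Om)
    rw [← mul_assoc ω, heff, zero_mul, map_zero, iContrL_mul X hO,
      ← (two_form_commute hO (iContrL X Om)).eq, mul_add, mul_smul_comm, ← mul_assoc ω, heff] at h
    simpa using h.symm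
  have hσ := mul_four_form hdim hOm hX (mul_mem_exteriorPower hα2 hα2)
  have hexp : (α - ξ • Om) ^ 3 = α * (α * α) - (3 * ξ) • (Om * (α * α)) +
      (3 * ξ ^ 2) • (α * (Om * Om)) - ξ ^ 3 • (Om * Om * Om) := by
    have h1 : α * (α * Om) = Om * (α * α) := by rw [hcomm, ← mul_assoc, hcomm, mul_assoc]
    have h2 : Om * (Om * α) = α * (Om * Om) := by rw [← hcomm, ← mul_assoc, ← hcomm, mul_assoc]
    have h3 : Om * (α * Om) = α * (Om * Om) := by rw [hcomm, h2]
    have h4 : α * (Om * α) = Om * (α * α) := by rw [← hcomm, h1]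
    simp only [pow_succ, pow_zero, one_mul, sub_mul, mul_sub, smul_mul_assoc, mul_smul_comm,
      mul_assoc, h1, h2, h3, h4]
    module
  rw [hexp, hcube, hprim, hσ]
  module
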